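/- arXiv:0912.1843 — 2 statements merged into one kernel-verified Lean document; each statement's English description precedes it below -/
import Mathlib

section
/- Let c be an integer with c ≤ 1, let n be a natural number, let q₁, …, qₙ be integers with qᵢ ≥ 2 for all i, and let k ≥ 1 be a natural number. If the rational number k·(c − Σᵢ₌₁ⁿ (1 − 1/qᵢ)) is negative, then k·(c − Σᵢ₌₁ⁿ (1 − 1/qᵢ)) ≤ −k/6. -/
/-- The defect `1 - 1 / q` of a cone point of multiplicity `q ≥ 2` is at least `1 / 2`. -/
lemma half_le_one_sub_one_div {q : ℤ} (hq : 2 ≤ q) : (1 / 2 : ℚ) ≤ 1 - 1 / (q : ℚ) := by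
  have h : (2 : ℚ) ≤ q := by exact_mod_cast hq
  have := one_div_le_one_div_of_le (by norm_num) h
  linarith

/-- The defect `1 - 1 / q` of a cone point of multiplicity `q ≥ 3` is at least `2 / 3`. -/
lemma two_thirds_le_one_sub_one_div {q : ℤ} (hq : 3 ≤ q) : (2 / 3 : ℚ) ≤ 1 - 1 / (q : ℚ) := by
  have h : (3 : ℚ) ≤ q := by exact_mod_cast hq
  have := one_div_le_one_div_of_le (by norm_num) h
  linarith

/-- The defects of `n` cone points add up to at least `n / 2`. -/
lemma half_card_le_sum_one_sub_one_div {n : ℕ} {q : Fin n → ℤ} (hq : ∀ i, 2 ≤ q i) :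
    (n : ℚ) / 2 ≤ ∑ i, (1 - 1 / (q i : ℚ)) := by
  have h := Finset.card_nsmul_le_sum Finset.univ (fun i => 1 - 1 / (q i : ℚ)) (1 / 2)
    fun i _ => half_le_one_sub_one_div (hq i)
  simp only [Finset.card_univ, Fintype.card_fin, nsmul_eq_mul] at h
  linarith

/-- A total defect exceeding `1` is at least `7 / 6`. -/
lemma seven_sixths_le_sum_one_sub_one_div {n : ℕ} {q : Fin n → ℤ} (hq : ∀ i, 2 ≤ q i)
    (h : 1 < ∑ i, (1 - 1 / (q i : ℚ))) : 7 / 6 ≤ ∑ i, (1 - 1 / (q i : ℚ)) := by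
  match n with
  | 0 => norm_num at h
  | 1 =>
    have hpos : (0 : ℚ) < q 0 := by exact_mod_cast (by linarith [hq 0] : 0 < q 0)
    have := one_div_pos.mpr hpos
    rw [Fin.sum_univ_one] at h
    linarith
  | 2 =>
    rw [Fin.sum_univ_two] at h ⊢
    have h₀ := half_le_one_sub_one_div (hq 0)
    have h₁ := half_le_one_sub_one_div (hq 1)
    rcases (hq 0).eq_or_lt with e₀ | l₀
    · rcases (hq 1).eq_or_lt with e₁ | l₁
      · rw [← e₀, ← e₁] at h
        norm_num at h
      · linarith [two_thirds_le_one_sub_one_div l₁]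
    · linarith [two_thirds_le_one_sub_one_div l₀]
  | m + 3 =>
    have hs := half_card_le_sum_one_sub_one_div hq
    push_cast at hs
    linarith [(Nat.cast_nonneg m : (0 : ℚ) ≤ m)]

/-- A negative orbifold Euler characteristic with underlying Euler characteristic at most `1`
is at most `-1 / 6`. -/
lemma sub_sum_one_sub_one_div_le {c : ℤ} (hc : c ≤ 1) {n : ℕ} {q : Fin n → ℤ}
    (hq : ∀ i, 2 ≤ q i) (h : (c : ℚ) - ∑ i, (1 - 1 / (q i : ℚ)) < 0) :
    (c : ℚ) - ∑ i, (1 - 1 / (q i : ℚ)) ≤ -1 / 6 := by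
  have hs := half_card_le_sum_one_sub_one_div hq
  rcases (by lia : c ≤ -1 ∨ c = 0 ∨ c = 1) with hc' | rfl | rfl
  · have : (c : ℚ) ≤ -1 := by exact_mod_cast hc'
    linarith [(Nat.cast_nonneg n : (0 : ℚ) ≤ n)]
  · rcases n.eq_zero_or_pos with rfl | hn
    · norm_num at h
    · have : (1 : ℚ) ≤ n := by exact_mod_cast hn
      push_cast
      linarith
  · push_cast at h ⊢
    linarith [seven_sixths_le_sum_one_sub_one_div hq (by linarith)]

theorem orbifold_euler_char_bound
    (c : ℤ) (hc : c ≤ 1) (n : ℕ) (q : Fin n → ℤ) (hq : ∀ i, 2 ≤ q i)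
    (k : ℕ) (hk : 1 ≤ k)
    (hneg : (k : ℚ) * ((c : ℚ) - ∑ i, (1 - 1 / (q i : ℚ))) < 0) :
    (k : ℚ) * ((c : ℚ) - ∑ i, (1 - 1 / (q i : ℚ))) ≤ -(k : ℚ) / 6 := by
  have hk' : (0 : ℚ) < k := by exact_mod_cast hk
  have h := sub_sum_one_sub_one_div_le hc hq (neg_of_mul_neg_right hneg hk'.le)
  linarith [mul_le_mul_of_nonneg_left h hk'.le]
end

section
/- For every real number R, 3.3957 · tanh(R)/cosh(2R) ≤ 1.0197. -/
/-- On `(-1, 1)` the cubic is nonnegative; it nearly vanishes at `t = √(√5 - 2) ≈ 0.485868`. -/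
theorem tube_cubic_bound {t : ℝ} (h₁ : -1 < t) (h₂ : t < 1) :
    3.3957 * t * (1 - t ^ 2) ≤ 1.0197 * (1 + t ^ 2) := by
  nlinarith [mul_nonneg (by linarith : 0 ≤ t + 1) (sq_nonneg (t - 0.485868)),
    sq_nonneg (t - 0.485868)]

theorem cosh_two_mul_mul_one_sub_tanh_sq (R : ℝ) :
    Real.cosh (2 * R) * (1 - Real.tanh R ^ 2) = 1 + Real.tanh R ^ 2 := by
  have hc : Real.cosh R ≠ 0 := (Real.cosh_pos R).ne'
  rw [Real.tanh_eq_sinh_div_cosh, Real.cosh_two_mul]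
  field_simp
  linear_combination Real.cosh_sq_sub_sinh_sq R

theorem tube_function_upper_bound (R : ℝ) :
    3.3957 * Real.tanh R / Real.cosh (2 * R) ≤ 1.0197 := by
  have h₁ := Real.neg_one_lt_tanh R
  have h₂ := Real.tanh_lt_one R
  have hpos : 0 < 1 - Real.tanh R ^ 2 := by nlinarith
  rw [div_le_iff₀ (Real.cosh_pos _)]
  refine le_of_mul_le_mul_right ?_ hpos
  rw [mul_assoc 1.0197, cosh_two_mul_mul_one_sub_tanh_sq]
  exact tube_cubic_bound h₁ h₂
end
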